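/- Let c̃ > 0 be such that H̄(c̃) := lim_{ρ→ρ₁(c̃)⁻} H(ρ, c̃) ≠ 0. Then there exists δ > 0 such that N(c) = N(c̃) for every c > 0 with |c − c̃| < δ. -/

import Mathlib

open Real Filter Set Topology Asymptotics MeasureTheory

noncomputable section

/-- The CSS (continuously self-similar) system for `(H, A, Z)` with derivative
function `H'`, on the interval `(0, ρ₁)`, together with the constraint, the
positivity/range conditions, and the initial conditions at `ρ = 0`:
`H(0) = -π/2`, `H'(0) = c`, `A(0) = 1`, `Z(0) = 0`, `Z'(0) = 1`.  This is the
notion of a `c`-orbit. -/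
structure IsCOrbit (α c : ℝ) (H H' A Z : ℝ → ℝ) (ρ₁ : ℝ) : Prop where
  rho1_pos : 0 < ρ₁
  hH : ∀ ρ ∈ Set.Ioo 0 ρ₁, HasDerivAt H (H' ρ) ρ
  hH' : ∀ ρ ∈ Set.Ioo 0 ρ₁, HasDerivAt H'
      (α * (1 + Z ρ ^ 2) * ρ * H' ρ ^ 3 - (2 / ρ) * H' ρ
        - Real.sin (2 * H ρ) / (A ρ * ρ ^ 2 * (1 - Z ρ ^ 2))) ρ
  hA : ∀ ρ ∈ Set.Ioo 0 ρ₁, HasDerivAt A (-2 * α * ρ * A ρ * H' ρ ^ 2) ρ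
  hZ : ∀ ρ ∈ Set.Ioo 0 ρ₁, HasDerivAt Z
      (Z ρ * (1 + α * (1 - Z ρ ^ 2) * ρ ^ 2 * H' ρ ^ 2) / ρ) ρ
  constraint : ∀ ρ ∈ Set.Ioo 0 ρ₁,
      1 - 2 * α - A ρ + 2 * α * Real.sin (H ρ) ^ 2
        + α * A ρ * ρ ^ 2 * H' ρ ^ 2 * (1 - Z ρ ^ 2) = 0
  hApos : ∀ ρ ∈ Set.Ioo 0 ρ₁, 0 < A ρ
  hZ01 : ∀ ρ ∈ Set.Ioo 0 ρ₁, 0 ≤ Z ρ ∧ Z ρ < 1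
  H0 : H 0 = -(π / 2)
  A0 : A 0 = 1
  Z0 : Z 0 = 0
  Hcont : Tendsto H (𝓝[>] 0) (𝓝 (-(π / 2)))
  H'init : Tendsto H' (𝓝[>] 0) (𝓝 c)
  Acont : Tendsto A (𝓝[>] 0) (𝓝 1)
  Zcont : Tendsto Z (𝓝[>] 0) (𝓝 0)
  Z'init : Tendsto (fun ρ => Z ρ / ρ) (𝓝[>] 0) (𝓝 1)

/-- A zero of `f` with a quantitatively nonzero derivative persists under a small perturbation. -/
theorem exists_zero_near_of_deriv_pos {f f' g : ℝ → ℝ} {z δ m : ℝ} (hδ : 0 < δ)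
    (hf : ∀ x ∈ Icc (z - δ) (z + δ), HasDerivAt f (f' x) x)
    (hg : ContinuousOn g (Icc (z - δ) (z + δ))) (hz : f z = 0)
    (hm : ∀ x ∈ Icc (z - δ) (z + δ), m ≤ f' x)
    (hfg : ∀ x ∈ Icc (z - δ) (z + δ), |f x - g x| < m * δ) :
    ∃ y ∈ Icc (z - δ) (z + δ), g y = 0 := by
  have hfc : ContinuousOn f (Icc (z - δ) (z + δ)) := fun x hx =>
    (hf x hx).continuousAt.continuousWithinAt
  obtain ⟨x, hx, hx'⟩ := exists_hasDerivAt_eq_slope f f' (show z < z + δ by linarith)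
    (hfc.mono (Icc_subset_Icc (by linarith) le_rfl))
    (fun x hx => hf x ⟨by linarith [hx.1], hx.2.le⟩)
  obtain ⟨y, hy, hy'⟩ := exists_hasDerivAt_eq_slope f f' (show z - δ < z by linarith)
    (hfc.mono (Icc_subset_Icc le_rfl (by linarith)))
    (fun x hx => hf x ⟨hx.1.le, by linarith [hx.2]⟩)
  have h1 := hm x ⟨by linarith [hx.1], hx.2.le⟩
  have h2 := hm y ⟨hy.1.le, by linarith [hy.2]⟩
  rw [hx', hz, le_div_iff₀ (by linarith)] at h1
  rw [hy', hz, le_div_iff₀ (by linarith)] at h2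
  have h3 := abs_lt.1 (hfg (z + δ) ⟨by linarith, le_rfl⟩)
  have h4 := abs_lt.1 (hfg (z - δ) ⟨le_rfl, by linarith⟩)
  exact intermediate_value_Icc (by linarith) hg ⟨by linarith [h4.1], by linarith [h3.2]⟩

/-- If the zeros of `f` are quantitatively simple and `g` is close to `f`, then `g` has at least as
many zeros as `f`. -/
theorem encard_zeros_le_of_close {f f' g : ℝ → ℝ} {a b m δ : ℝ} (hm : 0 < m) (hδ : 0 < δ)
    (hf : ∀ x ∈ Icc a b, HasDerivAt f (f' x) x) (hg : ContinuousOn g (Icc a b))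
    (hzero : ∀ x ∈ Icc a b, f x = 0 → m ≤ |f' x|)
    (hosc : ∀ x ∈ Icc a b, ∀ y ∈ Icc a b, |x - y| ≤ 2 * δ → |f' x - f' y| ≤ m / 2)
    (hleft : ∀ x ∈ Icc a b, x < a + δ → f x ≠ 0) (hright : ∀ x ∈ Icc a b, b - δ < x → f x ≠ 0)
    (hfg : ∀ x ∈ Icc a b, |f x - g x| < m / 2 * δ) :
    {x ∈ Icc a b | f x = 0}.encard ≤ {x ∈ Icc a b | g x = 0}.encard := by
  have key : ∀ z ∈ Icc a b, f z = 0 → ∃ y ∈ Icc (z - δ) (z + δ), y ∈ Icc a b ∧ g y = 0 := by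
    intro z hz hfz
    have ha : a + δ ≤ z := not_lt.1 fun h => hleft z hz h hfz
    have hb : z ≤ b - δ := not_lt.1 fun h => hright z hz h hfz
    have hsub : Icc (z - δ) (z + δ) ⊆ Icc a b := Icc_subset_Icc (by linarith) (by linarith)
    have hosc' : ∀ x ∈ Icc (z - δ) (z + δ), |f' z - f' x| ≤ m / 2 := fun x hx =>
      hosc z hz x (hsub hx) (abs_le.2 ⟨by linarith [hx.2], by linarith [hx.1]⟩)
    suffices ∃ y ∈ Icc (z - δ) (z + δ), g y = 0 by
      obtain ⟨y, hy, hgy⟩ := this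
      exact ⟨y, hy, hsub hy, hgy⟩
    rcases le_abs.1 (hzero z hz hfz) with h | h
    · exact exists_zero_near_of_deriv_pos hδ (fun x hx => hf x (hsub hx)) (hg.mono hsub) hfz
        (fun x hx => by linarith [abs_le.1 (hosc' x hx)]) (fun x hx => hfg x (hsub hx))
    · obtain ⟨y, hy, hgy⟩ := exists_zero_near_of_deriv_pos (f := fun x => -f x)
        (g := fun x => -g x) (m := m / 2) hδ (fun x hx => (hf x (hsub hx)).neg)
        (hg.mono hsub).neg (by simp [hfz])
        (fun x hx => by linarith [abs_le.1 (hosc' x hx)])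
        (fun x hx => by
          rw [neg_sub_neg, abs_sub_comm]
          exact hfg x (hsub hx))
      exact ⟨y, hy, neg_eq_zero.1 hgy⟩
  choose! φ hφ1 hφ2 using key
  have hinj : ∀ x ∈ Icc a b, ∀ y ∈ Icc a b, f x = 0 → f y = 0 → φ x = φ y → ¬ x < y := by
    intro x hx y hy hfx hfy hxy hlt
    have h1 := hφ1 x hx hfx
    have h2 := hφ1 y hy hfy
    rw [← hxy] at h2
    have hsub : Icc x y ⊆ Icc a b := Icc_subset_Icc hx.1 hy.2
    obtain ⟨ξ, hξ, hξ0⟩ := exists_hasDerivAt_eq_zero hlt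
      (fun t ht => (hf t (hsub ht)).continuousAt.continuousWithinAt) (hfx.trans hfy.symm)
      (fun t ht => hf t (hsub (Ioo_subset_Icc_self ht)))
    have h3 := hosc x hx ξ (hsub (Ioo_subset_Icc_self hξ))
      (abs_le.2 ⟨by linarith [hξ.2, h1.2, h2.1], by linarith [hξ.1]⟩)
    rw [hξ0, sub_zero] at h3
    linarith [hzero x hx hfx]
  refine encard_le_encard_of_injOn (f := φ) (fun x hx => hφ2 x hx.1 hx.2) ?_
  intro x hx y hy hxy
  exact le_antisymm (not_lt.1 (hinj y hy.1 x hx.1 hy.2 hx.2 hxy.symm))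
    (not_lt.1 (hinj x hx.1 y hy.1 hx.2 hy.2 hxy))

/-- The number of zeros on a compact interval of a function with only simple zeros, none of them at
an end point, is stable under `C¹`-small perturbations. -/
theorem exists_encard_zeros_eq_of_close {f f' : ℝ → ℝ} {a b : ℝ} (hab : a ≤ b)
    (hf : ∀ x ∈ Icc a b, HasDerivAt f (f' x) x) (hf' : ContinuousOn f' (Icc a b))
    (ha : f a ≠ 0) (hb : f b ≠ 0) (hsimple : ∀ x ∈ Icc a b, f x = 0 → f' x ≠ 0) :
    ∃ ε > 0, ∀ g g' : ℝ → ℝ, (∀ x ∈ Icc a b, HasDerivAt g (g' x) x) →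
      (∀ x ∈ Icc a b, |f x - g x| < ε) → (∀ x ∈ Icc a b, |f' x - g' x| < ε) →
      {x ∈ Icc a b | g x = 0}.encard = {x ∈ Icc a b | f x = 0}.encard := by
  have hfc : ContinuousOn f (Icc a b) := fun x hx => (hf x hx).continuousAt.continuousWithinAt
  obtain ⟨x₀, hx₀, hmin⟩ := isCompact_Icc.exists_isMinOn (nonempty_Icc.2 hab)
    (hfc.abs.add hf'.abs)
  set μ := |f x₀| + |f' x₀| with hμ
  have hmin : ∀ x ∈ Icc a b, μ ≤ |f x| + |f' x| := fun x hx => hmin hx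
  have hμ0 : 0 < μ := by
    by_cases h : f x₀ = 0
    · have := abs_pos.2 (hsimple x₀ hx₀ h)
      positivity
    · have := abs_pos.2 h
      positivity
  set ν := min |f a| |f b| / 2 with hν
  have hν0 : 0 < ν := half_pos (lt_min (abs_pos.2 ha) (abs_pos.2 hb))
  have hνa : 2 * ν ≤ |f a| := by linarith [min_le_left |f a| |f b|]
  have hνb : 2 * ν ≤ |f b| := by linarith [min_le_right |f a| |f b|]
  obtain ⟨δ₁, hδ₁, hu₁⟩ := Metric.uniformContinuousOn_iff.1
    (isCompact_Icc.uniformContinuousOn_of_continuous hfc) ν hν0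
  obtain ⟨δ₂, hδ₂, hu₂⟩ := Metric.uniformContinuousOn_iff.1
    (isCompact_Icc.uniformContinuousOn_of_continuous hf') (μ / 8) (by positivity)
  simp only [Real.dist_eq] at hu₁ hu₂
  set δ := min δ₁ δ₂ / 3 with hδ
  have hδ0 : 0 < δ := by positivity
  have hδ1 : 3 * δ ≤ δ₁ := by linarith [min_le_left δ₁ δ₂]
  have hδ2 : 3 * δ ≤ δ₂ := by linarith [min_le_right δ₁ δ₂]
  have hleft : ∀ x ∈ Icc a b, x < a + δ → ν < |f x| := by
    intro x hx hxa
    have := hu₁ x hx a (left_mem_Icc.2 hab) (abs_lt.2 ⟨by linarith [hx.1], by linarith⟩)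
    have h2 := abs_sub_abs_le_abs_sub (f a) (f x)
    rw [abs_sub_comm] at h2
    linarith
  have hright : ∀ x ∈ Icc a b, b - δ < x → ν < |f x| := by
    intro x hx hxa
    have := hu₁ x hx b (right_mem_Icc.2 hab) (abs_lt.2 ⟨by linarith, by linarith [hx.2]⟩)
    have h2 := abs_sub_abs_le_abs_sub (f b) (f x)
    rw [abs_sub_comm] at h2
    linarith
  refine ⟨min (min (μ / 16) ν) (μ / 4 * δ), by positivity, ?_⟩
  intro g g' hg hfg hfg'
  simp only [lt_min_iff] at hfg hfg'
  have hosc : ∀ x ∈ Icc a b, ∀ y ∈ Icc a b, |x - y| ≤ 2 * δ → |f' x - f' y| ≤ μ / 8 :=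
    fun x hx y hy h => (hu₂ x hx y hy (by linarith)).le
  refine le_antisymm ?_ ?_
  · refine encard_zeros_le_of_close (m := μ / 2) (δ := δ) (f' := g') (by positivity) hδ0 hg hfc
      ?_ ?_ ?_ ?_ ?_
    · intro x hx hgx
      have h1 := (hfg x hx).1.1
      rw [hgx, sub_zero] at h1
      have h2 := abs_sub_abs_le_abs_sub (f' x) (g' x)
      linarith [(hfg' x hx).1.1, hmin x hx]
    · intro x hx y hy hxy
      have h1 := abs_lt.1 (hfg' x hx).1.1
      have h2 := abs_lt.1 (hfg' y hy).1.1
      have h3 := abs_le.1 (hosc x hx y hy hxy)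
      exact abs_le.2 ⟨by linarith, by linarith⟩
    · intro x hx hxa hgx
      have h1 := (hfg x hx).1.2
      rw [hgx, sub_zero] at h1
      linarith [hleft x hx hxa]
    · intro x hx hxa hgx
      have h1 := (hfg x hx).1.2
      rw [hgx, sub_zero] at h1
      linarith [hright x hx hxa]
    · intro x hx
      rw [abs_sub_comm]
      linarith [(hfg x hx).2]
  · refine encard_zeros_le_of_close (m := μ / 2) (δ := δ) (f' := f') (by positivity) hδ0 hf
      (fun x hx => (hg x hx).continuousAt.continuousWithinAt) ?_ ?_ ?_ ?_ ?_
    · intro x hx hfx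
      have := hmin x hx
      rw [hfx, abs_zero, zero_add] at this
      linarith
    · intro x hx y hy hxy
      linarith [hosc x hx y hy hxy]
    · intro x hx hxa hfx
      have := hleft x hx hxa
      rw [hfx, abs_zero] at this
      linarith
    · intro x hx hxa hfx
      have := hright x hx hxa
      rw [hfx, abs_zero] at this
      linarith
    · intro x hx
      linarith [(hfg x hx).2]

/-- `F` is bounded on `U` and, when the parameter `c` is compared with the fixed parameter `c₀`,
Lipschitz with respect to the gauge `d`. -/
def IsLipAt (c₀ : ℝ) (U : Set (ℝ × ℝ)) (d : ℝ → ℝ → ℝ) (F : ℝ → ℝ → ℝ) : Prop :=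
  ∃ K : ℝ, 0 ≤ K ∧ ∀ c ρ, (c, ρ) ∈ U →
    |F c ρ| ≤ K ∧ |F c₀ ρ| ≤ K ∧ |F c ρ - F c₀ ρ| ≤ K * d c ρ

namespace IsLipAt

variable {c₀ : ℝ} {U : Set (ℝ × ℝ)} {d F G : ℝ → ℝ → ℝ}

theorem of_indep (hd : ∀ c ρ, 0 ≤ d c ρ) {φ : ℝ → ℝ} {K : ℝ}
    (hφ : ∀ c ρ, (c, ρ) ∈ U → |φ ρ| ≤ K) : IsLipAt c₀ U d fun _ ρ => φ ρ := by
  refine ⟨|K|, abs_nonneg _, fun c ρ h => ⟨(hφ c ρ h).trans (le_abs_self K),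
    (hφ c ρ h).trans (le_abs_self K), ?_⟩⟩
  simpa using mul_nonneg (abs_nonneg K) (hd c ρ)

theorem const (hd : ∀ c ρ, 0 ≤ d c ρ) (k : ℝ) : IsLipAt c₀ U d fun _ _ => k :=
  of_indep hd (φ := fun _ => k) fun _ _ _ => le_rfl

theorem add (hF : IsLipAt c₀ U d F) (hG : IsLipAt c₀ U d G) :
    IsLipAt c₀ U d fun c ρ => F c ρ + G c ρ := by
  obtain ⟨K, hK, hF⟩ := hF
  obtain ⟨L, hL, hG⟩ := hG
  refine ⟨K + L, by positivity, fun c ρ h => ?_⟩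
  obtain ⟨h1, h2, h3⟩ := hF c ρ h
  obtain ⟨h4, h5, h6⟩ := hG c ρ h
  refine ⟨(abs_add_le _ _).trans (add_le_add h1 h4), (abs_add_le _ _).trans (add_le_add h2 h5), ?_⟩
  rw [add_sub_add_comm, add_mul]
  exact (abs_add_le _ _).trans (add_le_add h3 h6)

theorem mul (hd : ∀ c ρ, 0 ≤ d c ρ) (hF : IsLipAt c₀ U d F) (hG : IsLipAt c₀ U d G) :
    IsLipAt c₀ U d fun c ρ => F c ρ * G c ρ := by
  obtain ⟨K, hK, hF⟩ := hF
  obtain ⟨L, hL, hG⟩ := hG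
  refine ⟨2 * K * L, by positivity, fun c ρ h => ?_⟩
  obtain ⟨h1, h2, h3⟩ := hF c ρ h
  obtain ⟨h4, h5, h6⟩ := hG c ρ h
  have hKL : 0 ≤ K * L := mul_nonneg hK hL
  refine ⟨?_, ?_, ?_⟩
  · rw [abs_mul]
    linarith [mul_le_mul h1 h4 (abs_nonneg _) hK]
  · rw [abs_mul]
    linarith [mul_le_mul h2 h5 (abs_nonneg _) hK]
  · rw [show F c ρ * G c ρ - F c₀ ρ * G c₀ ρ
      = F c ρ * (G c ρ - G c₀ ρ) + (F c ρ - F c₀ ρ) * G c₀ ρ by ring]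
    refine (abs_add_le _ _).trans ?_
    rw [abs_mul, abs_mul]
    linarith [mul_le_mul h1 h6 (abs_nonneg _) hK,
      mul_le_mul h3 h5 (abs_nonneg _) (mul_nonneg hK (hd c ρ))]

theorem neg (hF : IsLipAt c₀ U d F) : IsLipAt c₀ U d fun c ρ => -F c ρ := by
  obtain ⟨K, hK, hF⟩ := hF
  refine ⟨K, hK, fun c ρ h => ?_⟩
  obtain ⟨h1, h2, h3⟩ := hF c ρ h
  refine ⟨by rwa [abs_neg], by rwa [abs_neg], ?_⟩
  rwa [neg_sub_neg, abs_sub_comm]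

theorem sub (hF : IsLipAt c₀ U d F) (hG : IsLipAt c₀ U d G) :
    IsLipAt c₀ U d fun c ρ => F c ρ - G c ρ := by
  simpa only [sub_eq_add_neg] using hF.add hG.neg

theorem inv (hd : ∀ c ρ, 0 ≤ d c ρ) (hF : IsLipAt c₀ U d F) {k : ℝ} (hk : 0 < k)
    (hFk : ∀ c ρ, (c, ρ) ∈ U → k ≤ F c ρ ∧ k ≤ F c₀ ρ) :
    IsLipAt c₀ U d fun c ρ => (F c ρ)⁻¹ := by
  obtain ⟨K, hK, hF⟩ := hF
  refine ⟨k⁻¹ + k⁻¹ * k⁻¹ * K, by positivity, fun c ρ h => ?_⟩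
  obtain ⟨-, -, h3⟩ := hF c ρ h
  obtain ⟨h4, h5⟩ := hFk c ρ h
  have h6 : (F c ρ)⁻¹ ≤ k⁻¹ := inv_anti₀ hk h4
  have h7 : (F c₀ ρ)⁻¹ ≤ k⁻¹ := inv_anti₀ hk h5
  have p6 : 0 < F c ρ := hk.trans_le h4
  have p7 : 0 < F c₀ ρ := hk.trans_le h5
  have hpos : 0 ≤ k⁻¹ * k⁻¹ * K := by positivity
  have hd0 := hd c ρ
  refine ⟨?_, ?_, ?_⟩
  · rw [abs_of_pos (inv_pos.2 p6)]
    linarith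
  · rw [abs_of_pos (inv_pos.2 p7)]
    linarith
  · rw [inv_sub_inv p6.ne' p7.ne', div_eq_mul_inv, mul_inv, abs_mul, abs_sub_comm,
      abs_of_pos (by positivity : 0 < (F c ρ)⁻¹ * (F c₀ ρ)⁻¹)]
    have h8 : (F c ρ)⁻¹ * (F c₀ ρ)⁻¹ ≤ k⁻¹ * k⁻¹ := by gcongr
    have h9 := mul_le_mul h3 h8 (by positivity) (mul_nonneg hK hd0)
    have : 0 ≤ k⁻¹ * d c ρ := by positivity
    linarith

theorem congr (hF : IsLipAt c₀ U d F)
    (h : ∀ c ρ, (c, ρ) ∈ U → G c ρ = F c ρ ∧ G c₀ ρ = F c₀ ρ) : IsLipAt c₀ U d G := by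
  obtain ⟨K, hK, hF⟩ := hF
  refine ⟨K, hK, fun c ρ hc => ?_⟩
  rw [(h c ρ hc).1, (h c ρ hc).2]
  exact hF c ρ hc

theorem sin_div (hU : ∀ c ρ, (c, ρ) ∈ U → 0 < ρ) (hF : IsLipAt c₀ U d F) :
    IsLipAt c₀ U d fun c ρ => sin (ρ * F c ρ) / ρ := by
  obtain ⟨K, hK, hF⟩ := hF
  refine ⟨K, hK, fun c ρ hc => ?_⟩
  have hρ := hU c ρ hc
  obtain ⟨h1, h2, h3⟩ := hF c ρ hc
  have key : ∀ x y : ℝ, |sin (ρ * x) / ρ - sin (ρ * y) / ρ| ≤ |x - y| := by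
    intro x y
    rw [← sub_div, abs_div, abs_of_pos hρ, div_le_iff₀ hρ]
    refine (abs_sin_sub_sin_le _ _).trans_eq ?_
    rw [← mul_sub, abs_mul, abs_of_pos hρ, mul_comm]
  exact ⟨(by simpa using key (F c ρ) 0 : _ ≤ _).trans h1,
    (by simpa using key (F c₀ ρ) 0 : _ ≤ _).trans h2, (key _ _).trans h3⟩

theorem cos_mul {R : ℝ} (hU : ∀ c ρ, (c, ρ) ∈ U → 0 < ρ ∧ ρ ≤ R) (hd : ∀ c ρ, 0 ≤ d c ρ)
    (hF : IsLipAt c₀ U d F) : IsLipAt c₀ U d fun c ρ => cos (ρ * F c ρ) := by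
  obtain ⟨K, hK, hF⟩ := hF
  refine ⟨1 + |R| * K, by positivity, fun c ρ hc => ?_⟩
  obtain ⟨hρ, hR⟩ := hU c ρ hc
  obtain ⟨-, -, h3⟩ := hF c ρ hc
  have hpos : 0 ≤ |R| * K := by positivity
  refine ⟨(abs_cos_le_one _).trans (by linarith), (abs_cos_le_one _).trans (by linarith), ?_⟩
  refine (abs_cos_sub_cos_le _ _).trans ?_
  rw [← mul_sub, abs_mul, abs_of_pos hρ]
  have := mul_le_mul (hR.trans (le_abs_self R)) h3 (abs_nonneg _) (abs_nonneg R)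
  linarith [hd c ρ]

theorem sin_sub_div {R : ℝ} (hU : ∀ c ρ, (c, ρ) ∈ U → 0 < ρ ∧ ρ ≤ R) (hF : IsLipAt c₀ U d F) :
    IsLipAt c₀ U d fun c ρ => (sin (2 * (ρ * F c ρ)) - 2 * (ρ * F c ρ)) / ρ ^ 2 := by
  obtain ⟨K, hK, hF⟩ := hF
  have key : ∀ ρ, 0 < ρ → ρ ≤ R → ∀ x y : ℝ, |x| ≤ K → |y| ≤ K →
      |(sin (2 * (ρ * x)) - 2 * (ρ * x)) / ρ ^ 2 - (sin (2 * (ρ * y)) - 2 * (ρ * y)) / ρ ^ 2|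
        ≤ 4 * R * K ^ 2 * |x - y| := by
    intro ρ hρ hR x y hx hy
    have hderiv : ∀ t ∈ Icc (-K) K,
        HasDerivWithinAt (fun t => (sin (2 * (ρ * t)) - 2 * (ρ * t)) / ρ ^ 2)
          ((cos (2 * (ρ * t)) * (2 * ρ) - 2 * ρ) / ρ ^ 2) (Icc (-K) K) t := by
      intro t _
      have h1 : HasDerivAt (fun t : ℝ => 2 * (ρ * t)) (2 * ρ) t := by
        simpa using ((hasDerivAt_id t).const_mul ρ).const_mul 2
      exact ((h1.sin.sub h1).div_const _).hasDerivWithinAt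
    refine Convex.norm_image_sub_le_of_norm_hasDerivWithin_le hderiv ?_ (convex_Icc _ _)
      (abs_le.1 hy) (abs_le.1 hx)
    intro t ht
    have h2 : sin (ρ * t) ^ 2 ≤ (ρ * t) ^ 2 := sq_le_sq.2 abs_sin_le_abs
    have h3 : t ^ 2 ≤ K ^ 2 := sq_le_sq.2 (by rwa [abs_of_nonneg hK, abs_le])
    have h4 := cos_sq' (ρ * t)
    have hR1 : 0 < R := hρ.trans_le hR
    rw [show (cos (2 * (ρ * t)) * (2 * ρ) - 2 * ρ) / ρ ^ 2 = -(4 * sin (ρ * t) ^ 2 / ρ) by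
      rw [cos_two_mul, h4]; field_simp; ring]
    rw [norm_neg, Real.norm_of_nonneg (by positivity), div_le_iff₀ hρ]
    calc 4 * sin (ρ * t) ^ 2 ≤ 4 * (ρ * ρ * t ^ 2) := by linarith
      _ ≤ 4 * (R * ρ * K ^ 2) := by gcongr
      _ = 4 * R * K ^ 2 * ρ := by ring
  refine ⟨4 * |R| * K ^ 2 * K, by positivity, fun c ρ hc => ?_⟩
  obtain ⟨hρ, hR⟩ := hU c ρ hc
  obtain ⟨h1, h2, h3⟩ := hF c ρ hc
  have hR0 : |R| = R := abs_of_pos (hρ.trans_le hR)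
  have hR1 : 0 < R := hρ.trans_le hR
  rw [hR0]
  refine ⟨?_, ?_, ?_⟩
  · refine (by simpa using key ρ hρ hR (F c ρ) 0 h1 (by simpa) : _ ≤ _).trans ?_
    gcongr
  · refine (by simpa using key ρ hρ hR (F c₀ ρ) 0 h2 (by simpa) : _ ≤ _).trans ?_
    gcongr
  · refine (key ρ hρ hR _ _ h1 h2).trans ?_
    rw [mul_assoc _ K]
    gcongr

theorem of_abs_sub_le {M η : ℝ} (hd : ∀ c ρ, 0 ≤ d c ρ) (hM : ∀ c ρ, (c, ρ) ∈ U → |F c₀ ρ| ≤ M)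
    (hη : ∀ c ρ, (c, ρ) ∈ U → d c ρ ≤ η) (hF : ∀ c ρ, (c, ρ) ∈ U → |F c ρ - F c₀ ρ| ≤ d c ρ) :
    IsLipAt c₀ U d F := by
  refine ⟨|M| + |η| + 1, by positivity, fun c ρ h => ?_⟩
  have h1 := (hM c ρ h).trans (le_abs_self M)
  have h2 := (hη c ρ h).trans (le_abs_self η)
  have h3 := abs_sub_abs_le_abs_sub (F c ρ) (F c₀ ρ)
  have h4 := hF c ρ h
  have h5 : 0 ≤ (|M| + |η|) * d c ρ := mul_nonneg (by positivity) (hd c ρ)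
  exact ⟨by linarith, by linarith [abs_nonneg η], by linarith⟩

end IsLipAt

namespace IsCOrbit

variable {α c : ℝ} {H H' A Z : ℝ → ℝ} {ρ₁ : ℝ}

theorem one_sub_two_mul_le_A (h : IsCOrbit α c H H' A Z ρ₁) (hα : 0 < α) {ρ : ℝ}
    (hρ : ρ ∈ Ioo 0 ρ₁) : 1 - 2 * α + 2 * α * sin (H ρ) ^ 2 ≤ A ρ := by
  have h1 := h.constraint ρ hρ
  obtain ⟨hz0, hz1⟩ := h.hZ01 ρ hρ
  have h2 : 0 ≤ 1 - Z ρ ^ 2 := by nlinarith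
  have h3 : 0 ≤ α * A ρ * ρ ^ 2 * H' ρ ^ 2 * (1 - Z ρ ^ 2) := by
    have := (h.hApos ρ hρ).le
    positivity
  linarith

theorem one_sub_le_A (h : IsCOrbit α c H H' A Z ρ₁) (hα : 0 < α) {ρ : ℝ}
    (hρ : ρ ∈ Ioo 0 ρ₁) : 1 - 2 * α ≤ A ρ := by
  have : 0 ≤ 2 * α * sin (H ρ) ^ 2 := by positivity
  linarith [h.one_sub_two_mul_le_A hα hρ]

theorem antitoneOn_A (h : IsCOrbit α c H H' A Z ρ₁) (hα : 0 < α) : AntitoneOn A (Ioo 0 ρ₁) := by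
  refine antitoneOn_of_hasDerivWithinAt_nonpos (convex_Ioo _ _)
    (fun x hx => (h.hA x hx).continuousAt.continuousWithinAt) (f' := fun ρ => _)
    (fun x hx => ((h.hA x (interior_subset hx)).hasDerivWithinAt)) ?_
  intro x hx
  have hx := interior_subset hx
  have h1 := h.hApos x hx
  have h2 := hx.1
  have : 0 ≤ 2 * α * x * A x * H' x ^ 2 := by positivity
  linarith

theorem A_le_one (h : IsCOrbit α c H H' A Z ρ₁) (hα : 0 < α) {ρ : ℝ}
    (hρ : ρ ∈ Ioo 0 ρ₁) : A ρ ≤ 1 := by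
  refine ge_of_tendsto h.Acont ?_
  filter_upwards [Ioo_mem_nhdsGT hρ.1] with x hx
  exact h.antitoneOn_A hα ⟨hx.1, hx.2.trans hρ.2⟩ hρ hx.2.le

theorem hasDerivAt_Z_div (h : IsCOrbit α c H H' A Z ρ₁) {ρ : ℝ} (hρ : ρ ∈ Ioo 0 ρ₁) :
    HasDerivAt (fun ρ => Z ρ / ρ) (α * (Z ρ / ρ) * ρ * (1 - Z ρ ^ 2) * H' ρ ^ 2) ρ := by
  have h0 : ρ ≠ 0 := hρ.1.ne'
  refine ((h.hZ ρ hρ).div (hasDerivAt_id' ρ) h0).congr_deriv ?_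
  field_simp
  ring

theorem monotoneOn_Z_div (h : IsCOrbit α c H H' A Z ρ₁) (hα : 0 < α) :
    MonotoneOn (fun ρ => Z ρ / ρ) (Ioo 0 ρ₁) := by
  refine monotoneOn_of_hasDerivWithinAt_nonneg (convex_Ioo _ _)
    (fun x hx => (h.hasDerivAt_Z_div hx).continuousAt.continuousWithinAt) (f' := fun ρ => _)
    (fun x hx => (h.hasDerivAt_Z_div (interior_subset hx)).hasDerivWithinAt) ?_
  intro x hx
  have hx := interior_subset hx
  obtain ⟨h1, h3⟩ := h.hZ01 x hx
  have h2 := hx.1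
  have h4 : 0 ≤ 1 - Z x ^ 2 := by nlinarith
  positivity

theorem one_le_Z_div (h : IsCOrbit α c H H' A Z ρ₁) (hα : 0 < α) {ρ : ℝ}
    (hρ : ρ ∈ Ioo 0 ρ₁) : 1 ≤ Z ρ / ρ := by
  refine le_of_tendsto h.Z'init ?_
  filter_upwards [Ioo_mem_nhdsGT hρ.1] with x hx
  exact h.monotoneOn_Z_div hα ⟨hx.1, hx.2.trans hρ.2⟩ hρ hx.2.le

theorem Z_pos (h : IsCOrbit α c H H' A Z ρ₁) (hα : 0 < α) {ρ : ℝ}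
    (hρ : ρ ∈ Ioo 0 ρ₁) : 0 < Z ρ := by
  have h1 := h.one_le_Z_div hα hρ
  rw [le_div_iff₀ hρ.1] at h1
  linarith [hρ.1]

theorem tendsto_H_add_div (h : IsCOrbit α c H H' A Z ρ₁) :
    Tendsto (fun ρ => (H ρ + π / 2) / ρ) (𝓝[>] 0) (𝓝 c) := by
  have h1 : HasDerivWithinAt H c (Ici 0) 0 := by
    refine hasDerivWithinAt_Ici_of_tendsto_deriv (s := Ioo 0 ρ₁)
      (fun x hx => (h.hH x hx).differentiableAt.differentiableWithinAt) ?_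
      (Ioo_mem_nhdsGT h.rho1_pos) ?_
    · rw [ContinuousWithinAt, h.H0]
      exact h.Hcont.mono_left (nhdsWithin_mono _ fun x hx => hx.1)
    · refine h.H'init.congr' ?_
      filter_upwards [Ioo_mem_nhdsGT h.rho1_pos] with x hx
      exact (h.hH x hx).deriv.symm
  have h2 := (hasDerivWithinAt_iff_tendsto_slope' (s := Ioi 0) (by simp)).1
    (h1.mono Ioi_subset_Ici_self)
  refine h2.congr fun x => ?_
  rw [slope_def_field, h.H0, sub_neg_eq_add, sub_zero]

theorem H'_ne_zero (h : IsCOrbit α c H H' A Z ρ₁) (hα : 0 < α) {Hbar : ℝ}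
    (hHbar : Tendsto H (𝓝[<] ρ₁) (𝓝 Hbar)) (hne : Hbar ≠ 0) {ρ : ℝ} (hρ : ρ ∈ Ioo 0 ρ₁)
    (hH : H ρ = 0) : H' ρ ≠ 0 := by
  intro hH'
  have hA : A ρ = 1 - 2 * α := by
    have := h.constraint ρ hρ
    simp only [hH, hH', sin_zero] at this
    linarith
  have hzero : ∀ x ∈ Ico ρ ρ₁, H' x = 0 := by
    intro x hx
    have hx' : x ∈ Ioo 0 ρ₁ := ⟨hρ.1.trans_le hx.1, hx.2⟩
    have h1 := h.antitoneOn_A hα hρ hx' hx.1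
    have h2 := h.one_sub_le_A hα hx'
    have h3 := h.constraint x hx'
    have h4 : 0 < 1 - Z x ^ 2 := by
      obtain ⟨h5, h6⟩ := h.hZ01 x hx'
      nlinarith
    have h5 : 0 ≤ 2 * α * sin (H x) ^ 2 := by positivity
    have h6 := h.hApos x hx'
    have h7 := hx'.1
    have h8 : 0 < α * A x * x ^ 2 * (1 - Z x ^ 2) := by positivity
    by_contra hne'
    have h9 : 0 < H' x ^ 2 := by positivity
    have h10 := mul_pos h8 h9
    linarith
  have hconst : ∀ x ∈ Ico ρ ρ₁, H x = 0 := by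
    intro x hx
    have hsub : ∀ y ∈ Icc ρ x, y ∈ Ico ρ ρ₁ := fun y hy => ⟨hy.1, hy.2.trans_lt hx.2⟩
    have := constant_of_has_deriv_right_zero (f := H) (a := ρ) (b := x)
      (fun y hy => (h.hH y ⟨hρ.1.trans_le hy.1, (hsub y hy).2⟩).continuousAt.continuousWithinAt)
      (fun y hy => by
        have hy' := hsub y (Ico_subset_Icc_self hy)
        have := (h.hH y ⟨hρ.1.trans_le hy.1, hy'.2⟩).hasDerivWithinAt (s := Ici y)
        rwa [hzero y hy'] at this)
    rw [this x (right_mem_Icc.2 hx.1), hH]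
  refine hne (tendsto_nhds_unique hHbar (tendsto_const_nhds.congr' ?_))
  filter_upwards [Ioo_mem_nhdsLT hρ.2] with x hx
  exact (hconst x ⟨hx.1.le, hx.2⟩).symm

/-- Control of the variation of `H` near the right end of the interval: the integral of `ρ H'²` is
bounded by the variation of `A`, and the remaining logarithmic time by `Z`. -/
theorem abs_H_sub_le (h : IsCOrbit α c H H' A Z ρ₁) (hα0 : 0 < α) (hα : α < 1 / 2) {k : ℝ}
    (hk : 0 < k) {r ρ : ℝ} (hr : r ∈ Ioo 0 ρ₁) (hρ : ρ ∈ Ico r ρ₁) :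
    |H ρ - H r| ≤ (1 / Z r - 1) / (2 * k) + k / (2 * (1 - 2 * α)) := by
  set B := 1 - 2 * α with hB
  have hB0 : 0 < B := by linarith
  have hr0 := hr.1
  have hsub : Icc r ρ ⊆ Ioo 0 ρ₁ := fun x hx => ⟨hr0.trans_le hx.1, hx.2.trans_lt hρ.2⟩
  have hρ' : ρ ∈ Ioo 0 ρ₁ := hsub (right_mem_Icc.2 hρ.1)
  have hA : A r - A ρ ≤ 2 * α := by linarith [h.A_le_one hα0 hr, h.one_sub_le_A hα0 hρ']
  have hZr := h.Z_pos hα0 hr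
  have hquot : (ρ - r) / r ≤ 1 / Z r - 1 := by
    have h1 : Z r / r ≤ Z ρ / ρ := h.monotoneOn_Z_div hα0 hr hρ' hρ.1
    rw [div_le_div_iff₀ hr0 hρ'.1] at h1
    have h2 : ρ / r ≤ 1 / Z r := by
      rw [div_le_div_iff₀ hr0 hZr]
      nlinarith [(h.hZ01 ρ hρ').2]
    rw [sub_div, div_self hr0.ne']
    linarith
  have hderiv : ∀ x ∈ Icc r ρ, |H' x| ≤
      1 / (2 * k * r) + k / (4 * α * B) * (2 * α * x * A x * H' x ^ 2) := by
    intro x hx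
    have hx0 : 0 < x := hr0.trans_le hx.1
    have h1 := h.one_sub_le_A hα0 (hsub hx)
    have h2 : k / (4 * α * B) * (2 * α * x * A x * H' x ^ 2)
        = k * x * H' x ^ 2 / 2 * (A x / B) := by field_simp; ring
    have h3 : 1 ≤ A x / B := (one_le_div hB0).2 h1
    have h4 : k * x * H' x ^ 2 / 2 ≤ k * x * H' x ^ 2 / 2 * (A x / B) :=
      le_mul_of_one_le_right (by positivity) h3
    have h5 : 1 / (2 * k * x) ≤ 1 / (2 * k * r) := by
      have := hx.1
      gcongr
    have h6 : |H' x| ≤ 1 / (2 * k * x) + k * x * H' x ^ 2 / 2 := by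
      have h7 : 1 / (2 * k * x) + k * x * H' x ^ 2 / 2 - |H' x|
          = (1 - k * x * |H' x|) ^ 2 / (2 * k * x) := by
        rw [← sq_abs (H' x)]
        field_simp
        ring
      have h8 : 0 ≤ (1 - k * x * |H' x|) ^ 2 / (2 * k * x) := by positivity
      linarith
    linarith
  have hvar : ∀ σ : ℝ, |σ| = 1 → σ * (H ρ - H r) ≤
      1 / (2 * k * r) * (ρ - r) + k / (4 * α * B) * (A r - A ρ) := by
    intro σ hσ
    have hanti : AntitoneOn
        (fun x => σ * H x - 1 / (2 * k * r) * x + k / (4 * α * B) * A x) (Icc r ρ) := by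
      have hd : ∀ x ∈ Icc r ρ, HasDerivAt
          (fun x => σ * H x - 1 / (2 * k * r) * x + k / (4 * α * B) * A x)
          (σ * H' x - 1 / (2 * k * r) * 1
            + k / (4 * α * B) * (-2 * α * x * A x * H' x ^ 2)) x := fun x hx =>
        (((h.hH x (hsub hx)).const_mul σ).sub ((hasDerivAt_id x).const_mul _)).add
          ((h.hA x (hsub hx)).const_mul _)
      refine antitoneOn_of_hasDerivWithinAt_nonpos (convex_Icc _ _)
        (fun x hx => (hd x hx).continuousAt.continuousWithinAt) (f' := fun ρ => _)
        (fun x hx => (hd x (interior_subset hx)).hasDerivWithinAt) ?_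
      intro x hx
      have h1 := hderiv x (interior_subset hx)
      have h2 : σ * H' x ≤ |H' x| := by
        simpa [abs_mul, hσ] using le_abs_self (σ * H' x)
      linarith
    have := hanti (left_mem_Icc.2 hρ.1) (right_mem_Icc.2 hρ.1) hρ.1
    simp only at this
    linarith
  have hfin : 1 / (2 * k * r) * (ρ - r) + k / (4 * α * B) * (A r - A ρ)
      ≤ (1 / Z r - 1) / (2 * k) + k / (2 * B) := by
    have h1 : 1 / (2 * k * r) * (ρ - r) = (ρ - r) / r / (2 * k) := by field_simp
    have h2 : k / (4 * α * B) * (A r - A ρ) ≤ k / (4 * α * B) * (2 * α) := by gcongr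
    have h3 : k / (4 * α * B) * (2 * α) = k / (2 * B) := by field_simp; ring
    have h4 : (ρ - r) / r / (2 * k) ≤ (1 / Z r - 1) / (2 * k) := by gcongr
    linarith
  have h1 := hvar 1 (by simp)
  have h2 := hvar (-1) (by simp)
  exact abs_le.2 ⟨by linarith, by linarith⟩

end IsCOrbit

/-- The regular part of the equation for `H'`, in terms of `s = (H + π/2)/ρ`, `v = H'`, `ζ = Z/ρ`
and `a = A`. -/
def forcing (α ρ s v ζ a : ℝ) : ℝ :=
  α * (ρ * ((1 + ρ * ζ * (ρ * ζ)) * (v * (v * v))))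
    + (sin (2 * (ρ * s)) - 2 * (ρ * s)) / ρ ^ 2
    + 2 * (ρ * (sin (ρ * s) / ρ * cos (ρ * s)))
      * (2 * α * (sin (ρ * s) / ρ * (sin (ρ * s) / ρ))
        - α * (a * (v * v * (1 - ρ * ζ * (ρ * ζ)))) + a * (ζ * ζ))
      * (a⁻¹ * (1 - ρ * ζ * (ρ * ζ))⁻¹)

/-- The squared distance between the orbits with parameters `c` and `c₀`, in variables which are
regular at `ρ = 0`. -/
def sqGap (H H' Z : ℝ → ℝ → ℝ) (c₀ c ρ : ℝ) : ℝ :=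
  2 * ((H c ρ + π / 2) / ρ - (H c₀ ρ + π / 2) / ρ) ^ 2 + (H' c ρ - H' c₀ ρ) ^ 2
    + (Z c ρ / ρ - Z c₀ ρ / ρ) ^ 2

theorem sqGap_nonneg (H H' Z : ℝ → ℝ → ℝ) (c₀ c ρ : ℝ) : 0 ≤ sqGap H H' Z c₀ c ρ := by
  unfold sqGap
  positivity

theorem abs_H_sub_le_sqrt_sqGap (H H' Z : ℝ → ℝ → ℝ) (c₀ c ρ : ℝ) :
    |(H c ρ + π / 2) / ρ - (H c₀ ρ + π / 2) / ρ| ≤ √(sqGap H H' Z c₀ c ρ) := by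
  refine abs_le_sqrt ?_
  unfold sqGap
  nlinarith [sq_nonneg ((H c ρ + π / 2) / ρ - (H c₀ ρ + π / 2) / ρ),
    sq_nonneg (H' c ρ - H' c₀ ρ), sq_nonneg (Z c ρ / ρ - Z c₀ ρ / ρ)]

theorem abs_H'_sub_le_sqrt_sqGap (H H' Z : ℝ → ℝ → ℝ) (c₀ c ρ : ℝ) :
    |H' c ρ - H' c₀ ρ| ≤ √(sqGap H H' Z c₀ c ρ) := by
  refine abs_le_sqrt ?_
  unfold sqGap
  nlinarith [sq_nonneg ((H c ρ + π / 2) / ρ - (H c₀ ρ + π / 2) / ρ),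
    sq_nonneg (Z c ρ / ρ - Z c₀ ρ / ρ)]

theorem abs_Z_sub_le_sqrt_sqGap (H H' Z : ℝ → ℝ → ℝ) (c₀ c ρ : ℝ) :
    |Z c ρ / ρ - Z c₀ ρ / ρ| ≤ √(sqGap H H' Z c₀ c ρ) := by
  refine abs_le_sqrt ?_
  unfold sqGap
  nlinarith [sq_nonneg ((H c ρ + π / 2) / ρ - (H c₀ ρ + π / 2) / ρ),
    sq_nonneg (H' c ρ - H' c₀ ρ)]

theorem sin_sq_eq_one_sub_sin_sq_add_pi_div_two (x : ℝ) :
    sin x ^ 2 = 1 - sin (x + π / 2) ^ 2 := by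
  rw [sin_add_pi_div_two, ← sin_sq]

namespace IsCOrbit

variable {α c : ℝ} {H H' A Z : ℝ → ℝ} {ρ₁ : ℝ}

theorem one_sub_sq_pos (h : IsCOrbit α c H H' A Z ρ₁) {ρ : ℝ} (hρ : ρ ∈ Ioo 0 ρ₁) :
    0 < 1 - Z ρ ^ 2 := by
  obtain ⟨h1, h2⟩ := h.hZ01 ρ hρ
  nlinarith

theorem hasDerivAt_H_add_div (h : IsCOrbit α c H H' A Z ρ₁) {ρ : ℝ} (hρ : ρ ∈ Ioo 0 ρ₁) :
    HasDerivAt (fun ρ => (H ρ + π / 2) / ρ) ((H' ρ - (H ρ + π / 2) / ρ) / ρ) ρ := by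
  have h0 : ρ ≠ 0 := hρ.1.ne'
  refine (((h.hH ρ hρ).add_const (π / 2)).div (hasDerivAt_id' ρ) h0).congr_deriv ?_
  field_simp

theorem hasDerivAt_H' (h : IsCOrbit α c H H' A Z ρ₁) {ρ : ℝ} (hρ : ρ ∈ Ioo 0 ρ₁) :
    HasDerivAt H' (2 * ((H ρ + π / 2) / ρ - H' ρ) / ρ
      + forcing α ρ ((H ρ + π / 2) / ρ) (H' ρ) (Z ρ / ρ) (A ρ)) ρ := by
  convert h.hH' ρ hρ using 1
  have h0 : ρ ≠ 0 := hρ.1.ne'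
  have hA := (h.hApos ρ hρ).ne'
  have hZ := (h.one_sub_sq_pos hρ).ne'
  have hc := h.constraint ρ hρ
  rw [sin_sq_eq_one_sub_sin_sq_add_pi_div_two] at hc
  have hs : sin (2 * H ρ) = -(2 * sin (H ρ + π / 2) * cos (H ρ + π / 2)) := by
    rw [← sin_two_mul, ← sin_sub_pi]
    ring_nf
  rw [hs, forcing, mul_div_cancel₀ _ h0, mul_div_cancel₀ _ h0, sin_two_mul]
  generalize sin (H ρ + π / 2) = S at *
  generalize cos (H ρ + π / 2) = C at *
  rw [← pow_two (Z ρ)]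
  have key : 2 * α * (S / ρ * (S / ρ)) - α * (A ρ * (H' ρ * H' ρ * (1 - Z ρ ^ 2)))
      + A ρ * (Z ρ / ρ * (Z ρ / ρ)) = (1 - A ρ * (1 - Z ρ ^ 2)) / ρ ^ 2 := by
    field_simp
    linear_combination -hc
  rw [key]
  field_simp
  ring

theorem A_eq (h : IsCOrbit α c H H' A Z ρ₁) (hα0 : 0 < α) (hα : α < 1 / 2)
    {ρ : ℝ} (hρ : ρ ∈ Ioo 0 ρ₁) :
    1 - 2 * α ≤ 1 - α * (ρ * ρ * (H' ρ * H' ρ * (1 - ρ * (Z ρ / ρ) * (ρ * (Z ρ / ρ))))) ∧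
    A ρ = (1 - 2 * α * (ρ * (sin (ρ * ((H ρ + π / 2) / ρ)) / ρ)
        * (ρ * (sin (ρ * ((H ρ + π / 2) / ρ)) / ρ))))
      * (1 - α * (ρ * ρ * (H' ρ * H' ρ * (1 - ρ * (Z ρ / ρ) * (ρ * (Z ρ / ρ))))))⁻¹ := by
  have h0 : ρ ≠ 0 := hρ.1.ne'
  simp only [mul_div_cancel₀ _ h0]
  have hc := h.constraint ρ hρ
  rw [sin_sq_eq_one_sub_sin_sq_add_pi_div_two] at hc
  have hA0 := h.hApos ρ hρ
  have hA1 := h.A_le_one hα0 hρ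
  have hS := sin_sq_le_one (H ρ + π / 2)
  have hprod : A ρ * (1 - α * (ρ * ρ * (H' ρ * H' ρ * (1 - Z ρ * Z ρ))))
      = 1 - 2 * α * (sin (H ρ + π / 2) * sin (H ρ + π / 2)) := by
    linear_combination -hc
  have hle : 1 - 2 * α ≤ 1 - α * (ρ * ρ * (H' ρ * H' ρ * (1 - Z ρ * Z ρ))) := by
    have h1 : 1 - 2 * α ≤ A ρ * (1 - α * (ρ * ρ * (H' ρ * H' ρ * (1 - Z ρ * Z ρ)))) := by
      rw [hprod]
      nlinarith
    by_contra! hlt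
    nlinarith
  refine ⟨hle, ?_⟩
  rw [← div_eq_mul_inv, eq_div_iff (by linarith), hprod]

end IsCOrbit

theorem exists_bound_Ioc {f : ℝ → ℝ} {b l : ℝ} (hf : ContinuousOn f (Ioc 0 b))
    (hl : Tendsto f (𝓝[>] 0) (𝓝 l)) : ∃ M, ∀ x ∈ Ioc 0 b, |f x| ≤ M := by
  have h1 : ∀ᶠ x in 𝓝[>] (0 : ℝ), |f x| < |l| + 1 := hl.abs.eventually_lt_const (by linarith)
  obtain ⟨a, ha, ha'⟩ := (mem_nhdsGT_iff_exists_Ioo_subset).1 h1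
  obtain ⟨M, hM⟩ := isCompact_Icc.exists_bound_of_continuousOn
    (hf.mono (fun x hx => ⟨lt_of_lt_of_le ha hx.1, hx.2⟩ : Icc a b ⊆ Ioc 0 b))
  refine ⟨max (|l| + 1) M, fun x hx => ?_⟩
  rcases lt_or_ge x a with h | h
  · exact le_max_of_le_left (le_of_lt (ha' ⟨hx.1, h⟩))
  · exact le_max_of_le_right (hM x ⟨h, hx.2⟩)

section Family

variable {α : ℝ} {H H' A Z : ℝ → ℝ → ℝ} {ρ₁ : ℝ → ℝ} {c₀ : ℝ}

/-- As long as the `c`-orbit stays in a suitable tube around the `c₀`-orbit, `Z` stays away from `1`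
and the regular parts of the equations are Lipschitz. -/
theorem exists_lipschitz_tube (hα0 : 0 < α) (hα : α < 1 / 2)
    (horb : ∀ c, 0 < c → IsCOrbit α c (H c) (H' c) (A c) (Z c) (ρ₁ c)) (hc₀ : 0 < c₀)
    {r : ℝ} (hr : r ∈ Ioo 0 (ρ₁ c₀)) :
    ∃ η > 0, ∃ q < 1, ∃ K ≥ 0, ∀ c, 0 < c → ∀ ρ ∈ Ioo 0 (ρ₁ c), ρ ≤ r →
      sqGap H H' Z c₀ c ρ ≤ η → Z c ρ ≤ q ∧
      |forcing α ρ ((H c ρ + π / 2) / ρ) (H' c ρ) (Z c ρ / ρ) (A c ρ)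
        - forcing α ρ ((H c₀ ρ + π / 2) / ρ) (H' c₀ ρ) (Z c₀ ρ / ρ) (A c₀ ρ)|
        ≤ K * √(sqGap H H' Z c₀ c ρ) ∧
      |α * (Z c ρ / ρ) * ρ * (1 - Z c ρ ^ 2) * H' c ρ ^ 2
        - α * (Z c₀ ρ / ρ) * ρ * (1 - Z c₀ ρ ^ 2) * H' c₀ ρ ^ 2|
        ≤ K * √(sqGap H H' Z c₀ c ρ) := by
  have h₀ := horb c₀ hc₀
  have hr0 := hr.1
  obtain ⟨hZr0, hZr1⟩ := h₀.hZ01 r hr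
  set η := (1 - Z c₀ r) / (2 * r) with hη
  have hη0 : 0 < η := div_pos (by linarith) (by linarith)
  set q := (1 + Z c₀ r) / 2 with hq
  have hq1 : q < 1 := by linarith
  set U : Set (ℝ × ℝ) := {p | 0 < p.1 ∧ p.2 ∈ Ioo 0 (ρ₁ p.1) ∧ p.2 ≤ r ∧
    sqGap H H' Z c₀ p.1 p.2 ≤ η ^ 2} with hU
  set d : ℝ → ℝ → ℝ := fun c ρ => √(sqGap H H' Z c₀ c ρ) with hd
  have hd0 : ∀ c ρ, 0 ≤ d c ρ := fun c ρ => sqrt_nonneg _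
  have hdη : ∀ c ρ, (c, ρ) ∈ U → d c ρ ≤ η := fun c ρ h => sqrt_le_iff.2 ⟨hη0.le, h.2.2.2⟩
  have hUr : ∀ c ρ, (c, ρ) ∈ U → 0 < ρ ∧ ρ ≤ r := fun c ρ h => ⟨h.2.1.1, h.2.2.1⟩
  have hmem₀ : ∀ ρ ∈ Ioc 0 r, ρ ∈ Ioo 0 (ρ₁ c₀) := fun ρ h => ⟨h.1, h.2.trans_lt hr.2⟩
  have hU₀ : ∀ c ρ, (c, ρ) ∈ U → ρ ∈ Ioo 0 (ρ₁ c₀) := fun c ρ h => hmem₀ ρ (hUr c ρ h)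
  have hZq : ∀ c ρ, (c, ρ) ∈ U → Z c ρ ≤ q ∧ Z c₀ ρ ≤ q := by
    intro c ρ h
    have hρ := (hUr c ρ h).1
    have h1 : Z c₀ ρ / ρ ≤ Z c₀ r / r := h₀.monotoneOn_Z_div hα0 (hU₀ c ρ h) hr (hUr c ρ h).2
    have h2 := (abs_le.1 ((abs_Z_sub_le_sqrt_sqGap H H' Z c₀ c ρ).trans (hdη c ρ h))).2
    have h3 : r * (Z c₀ r / r + η) = q := by
      rw [hη, hq]
      field_simp
      ring
    have h4 : 0 ≤ Z c₀ r / r + η := by positivity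
    have h5 : ρ * (Z c₀ r / r + η) ≤ q := by
      rw [← h3]
      exact mul_le_mul_of_nonneg_right (hUr c ρ h).2 h4
    constructor
    · rw [← mul_div_cancel₀ (Z c ρ) hρ.ne']
      exact (mul_le_mul_of_nonneg_left (by linarith) hρ.le).trans h5
    · rw [← mul_div_cancel₀ (Z c₀ ρ) hρ.ne']
      exact (mul_le_mul_of_nonneg_left (by linarith) hρ.le).trans h5
  obtain ⟨Ms, hMs⟩ := exists_bound_Ioc (b := r) (fun x hx =>
    (h₀.hasDerivAt_H_add_div (hmem₀ x hx)).continuousAt.continuousWithinAt) h₀.tendsto_H_add_div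
  obtain ⟨Mv, hMv⟩ := exists_bound_Ioc (b := r) (fun x hx =>
    (h₀.hH' x (hmem₀ x hx)).continuousAt.continuousWithinAt) h₀.H'init
  obtain ⟨Mz, hMz⟩ := exists_bound_Ioc (b := r) (fun x hx =>
    (h₀.hasDerivAt_Z_div (hmem₀ x hx)).continuousAt.continuousWithinAt) h₀.Z'init
  have Lρ : IsLipAt c₀ U d fun _ ρ => ρ :=
    .of_indep (K := r) hd0 fun c ρ h => by
      rw [abs_of_pos (hUr c ρ h).1]
      exact (hUr c ρ h).2
  have Ls : IsLipAt c₀ U d fun c ρ => (H c ρ + π / 2) / ρ :=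
    .of_abs_sub_le hd0 (fun c ρ h => hMs ρ (hUr c ρ h)) hdη
      fun c ρ _ => abs_H_sub_le_sqrt_sqGap H H' Z c₀ c ρ
  have Lv : IsLipAt c₀ U d H' :=
    .of_abs_sub_le hd0 (fun c ρ h => hMv ρ (hUr c ρ h)) hdη
      fun c ρ _ => abs_H'_sub_le_sqrt_sqGap H H' Z c₀ c ρ
  have Lζ : IsLipAt c₀ U d fun c ρ => Z c ρ / ρ :=
    .of_abs_sub_le hd0 (fun c ρ h => hMz ρ (hUr c ρ h)) hdη
      fun c ρ _ => abs_Z_sub_le_sqrt_sqGap H H' Z c₀ c ρ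
  have LS := Ls.sin_div fun c ρ h => (hUr c ρ h).1
  have LC := Ls.cos_mul hUr hd0
  have LR := Ls.sin_sub_div hUr
  have Lk : ∀ k : ℝ, IsLipAt c₀ U d fun _ _ => k := fun k => .const hd0 k
  have LZ := Lρ.mul hd0 Lζ
  have LZZ := LZ.mul hd0 LZ
  have LD := (Lk 1).sub LZZ
  have Lvv := Lv.mul hd0 Lv
  have LvD := Lvv.mul hd0 LD
  have LA : IsLipAt c₀ U d A := by
    have LρS := Lρ.mul hd0 LS
    have hle : ∀ c ρ, (c, ρ) ∈ U → _ := fun c ρ h =>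
      And.intro ((horb c h.1).A_eq hα0 hα h.2.1) (h₀.A_eq hα0 hα (hU₀ c ρ h))
    refine (((Lk 1).sub ((((Lk 2).mul hd0 (Lk α)).mul hd0 LρS).mul hd0 LρS)).mul hd0
      (((Lk 1).sub ((Lk α).mul hd0 ((Lρ.mul hd0 Lρ).mul hd0 LvD))).inv hd0
        (k := 1 - 2 * α) (by linarith) fun c ρ h => ⟨(hle c ρ h).1.1, (hle c ρ h).2.1⟩)).congr
      fun c ρ h => ⟨(hle c ρ h).1.2.trans (by ring), (hle c ρ h).2.2.trans (by ring)⟩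
  have LAinv := LA.inv hd0 (k := 1 - 2 * α) (by linarith) fun c ρ h =>
    ⟨(horb c h.1).one_sub_le_A hα0 h.2.1, h₀.one_sub_le_A hα0 (hU₀ c ρ h)⟩
  have LDinv := LD.inv hd0 (k := 1 - q) (by linarith) fun c ρ h => by
    have hρ := (hUr c ρ h).1.ne'
    rw [mul_div_cancel₀ _ hρ, mul_div_cancel₀ _ hρ]
    obtain ⟨h1, h2⟩ := hZq c ρ h
    obtain ⟨h3, h4⟩ := (horb c h.1).hZ01 ρ h.2.1
    obtain ⟨h5, h6⟩ := h₀.hZ01 ρ (hU₀ c ρ h)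
    constructor <;> nlinarith
  have LG : IsLipAt c₀ U d fun c ρ =>
      forcing α ρ ((H c ρ + π / 2) / ρ) (H' c ρ) (Z c ρ / ρ) (A c ρ) :=
    (((Lk α).mul hd0 (Lρ.mul hd0 (((Lk 1).add LZZ).mul hd0 (Lv.mul hd0 Lvv)))).add LR).add
      ((((Lk 2).mul hd0 (Lρ.mul hd0 (LS.mul hd0 LC))).mul hd0
        (((((Lk 2).mul hd0 (Lk α)).mul hd0 (LS.mul hd0 LS)).sub
          ((Lk α).mul hd0 (LA.mul hd0 LvD))).add (LA.mul hd0 (Lζ.mul hd0 Lζ)))).mul hd0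
        (LAinv.mul hd0 LDinv))
  have LJ : IsLipAt c₀ U d fun c ρ => α * (Z c ρ / ρ) * ρ * (1 - Z c ρ ^ 2) * H' c ρ ^ 2 := by
    refine (((((Lk α).mul hd0 Lζ).mul hd0 Lρ).mul hd0 LD).mul hd0 Lvv).congr fun c ρ h => ?_
    have hρ := (hUr c ρ h).1.ne'
    simp only [mul_div_cancel₀ _ hρ, pow_two, and_self]
  obtain ⟨K₁, hK₁, hG⟩ := LG
  obtain ⟨K₂, hK₂, hJ⟩ := LJ
  refine ⟨η ^ 2, by positivity, q, hq1, max K₁ K₂, le_max_of_le_left hK₁, ?_⟩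
  intro c hc ρ hρ hρr hgap
  have hmem : (c, ρ) ∈ U := ⟨hc, hρ, hρr, hgap⟩
  exact ⟨(hZq c ρ hmem).1,
    (hG c ρ hmem).2.2.trans (mul_le_mul_of_nonneg_right (le_max_left _ _) (hd0 c ρ)),
    (hJ c ρ hmem).2.2.trans (mul_le_mul_of_nonneg_right (le_max_right _ _) (hd0 c ρ))⟩

theorem tendsto_sqGap {c : ℝ} (h : IsCOrbit α c (H c) (H' c) (A c) (Z c) (ρ₁ c))
    (h₀ : IsCOrbit α c₀ (H c₀) (H' c₀) (A c₀) (Z c₀) (ρ₁ c₀)) :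
    Tendsto (sqGap H H' Z c₀ c) (𝓝[>] 0) (𝓝 (3 * (c - c₀) ^ 2)) := by
  have := ((((h.tendsto_H_add_div.sub h₀.tendsto_H_add_div).pow 2).const_mul 2).add
    ((h.H'init.sub h₀.H'init).pow 2)).add ((h.Z'init.sub h₀.Z'init).pow 2)
  rw [show 3 * (c - c₀) ^ 2 = 2 * (c - c₀) ^ 2 + (c - c₀) ^ 2 + (1 - 1) ^ 2 by ring]
  exact this

/-- Continuous dependence of the orbit on `c`, uniformly on `(0, r]`. -/
theorem exists_forall_sqGap_lt (hα0 : 0 < α) (hα : α < 1 / 2)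
    (horb : ∀ c, 0 < c → IsCOrbit α c (H c) (H' c) (A c) (Z c) (ρ₁ c))
    (hend : ∀ c, 0 < c → Tendsto (Z c) (𝓝[<] ρ₁ c) (𝓝 1)) (hc₀ : 0 < c₀)
    {r : ℝ} (hr : r ∈ Ioo 0 (ρ₁ c₀)) {ε : ℝ} (hε : 0 < ε) :
    ∃ δ > 0, ∀ c, 0 < c → |c - c₀| < δ →
      r < ρ₁ c ∧ ∀ ρ ∈ Ioc 0 r, sqGap H H' Z c₀ c ρ < ε := by
  obtain ⟨η, hη, q, hq, K, hK, htube⟩ := exists_lipschitz_tube hα0 hα horb hc₀ hr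
  have h₀ := horb c₀ hc₀
  set L := 4 * K + 1 with hL
  set μ := min η ε / 2 * exp (-(L * r)) with hμ
  have hμ0 : 0 < μ := by positivity
  have hμr : μ * exp (L * r) = min η ε / 2 := by
    rw [hμ, mul_assoc, ← exp_add, neg_add_cancel, exp_zero, mul_one]
  refine ⟨√(μ / 3), by positivity, fun c hc hcδ => ?_⟩
  have h := horb c hc
  have hcμ : 3 * (c - c₀) ^ 2 < μ := by
    have := (lt_sqrt (abs_nonneg _)).1 hcδ
    rw [sq_abs] at this
    linarith
  have hbound : ∀ ρ ∈ Ioo 0 (ρ₁ c), ρ ≤ r → sqGap H H' Z c₀ c ρ ≤ min η ε / 2 := by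
    intro ρ hρ hρr
    obtain ⟨a, ha, ha0, haρ⟩ := (((tendsto_sqGap h h₀).eventually_lt_const hcμ).and
      (Ioo_mem_nhdsGT hρ.1)).exists
    have hmem : ∀ x ∈ Icc a ρ, x ∈ Ioo 0 (ρ₁ c) := fun x hx =>
      ⟨ha0.trans_le hx.1, hx.2.trans_lt hρ.2⟩
    have hmem₀ : ∀ x ∈ Icc a ρ, x ∈ Ioo 0 (ρ₁ c₀) := fun x hx =>
      ⟨ha0.trans_le hx.1, (hx.2.trans hρr).trans_lt hr.2⟩
    have hderiv : ∀ x ∈ Icc a ρ, HasDerivAt (sqGap H H' Z c₀ c) _ x := fun x hx =>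
      (((((h.hasDerivAt_H_add_div (hmem x hx)).sub
        (h₀.hasDerivAt_H_add_div (hmem₀ x hx))).pow 2).const_mul 2).add
        (((h.hasDerivAt_H' (hmem x hx)).sub (h₀.hasDerivAt_H' (hmem₀ x hx))).pow 2)).add
        (((h.hasDerivAt_Z_div (hmem x hx)).sub (h₀.hasDerivAt_Z_div (hmem₀ x hx))).pow 2)
    have hB : ∀ x, HasDerivAt (fun x => μ * exp (L * x)) (μ * (exp (L * x) * L)) x := fun x => by
      simpa using (((hasDerivAt_id x).const_mul L).exp).const_mul μ
    have hBr : ∀ x ≤ r, μ * exp (L * x) ≤ min η ε / 2 := by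
      intro x hx
      rw [← hμr]
      gcongr
    refine (image_le_of_deriv_right_lt_deriv_boundary
      (fun x hx => (hderiv x hx).continuousAt.continuousWithinAt)
      (fun x hx => (hderiv x (Ico_subset_Icc_self hx)).hasDerivWithinAt) ?_ hB ?_
      (right_mem_Icc.2 haρ.le)).trans (hBr ρ hρr)
    · refine ha.le.trans (le_mul_of_one_le_right hμ0.le (one_le_exp ?_))
      positivity
    · intro x hx hxB
      have hx := Ico_subset_Icc_self hx
      have hx0 : 0 < x := (hmem x hx).1
      have hxr : x ≤ r := hx.2.trans hρr
      have hBpos : 0 < μ * exp (L * x) := by positivity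
      obtain ⟨-, hG, hJ⟩ := htube c hc x (hmem x hx) hxr (by
        rw [hxB]
        linarith [hBr x hxr, min_le_left η ε])
      have hv := abs_H'_sub_le_sqrt_sqGap H H' Z c₀ c x
      have hz := abs_Z_sub_le_sqrt_sqGap H H' Z c₀ c x
      have hsq := mul_self_sqrt (sqGap_nonneg H H' Z c₀ c x)
      generalize forcing α x ((H c x + π / 2) / x) (H' c x) (Z c x / x) (A c x) = G at *
      generalize forcing α x ((H c₀ x + π / 2) / x) (H' c₀ x) (Z c₀ x / x) (A c₀ x) = G₀ at *
      generalize α * (Z c x / x) * x * (1 - Z c x ^ 2) * H' c x ^ 2 = J at *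
      generalize α * (Z c₀ x / x) * x * (1 - Z c₀ x ^ 2) * H' c₀ x ^ 2 = J₀ at *
      rw [hxB] at hsq hG hJ hv hz
      set y := √(μ * exp (L * x)) with hy
      have hy0 : 0 ≤ y := sqrt_nonneg _
      have h1 : (H' c x - H' c₀ x) * (G - G₀) ≤ y * (K * y) :=
        (le_abs_self _).trans ((abs_mul _ _).trans_le (mul_le_mul hv hG (abs_nonneg _) hy0))
      have h2 : (Z c x / x - Z c₀ x / x) * (J - J₀) ≤ y * (K * y) :=
        (le_abs_self _).trans ((abs_mul _ _).trans_le (mul_le_mul hz hJ (abs_nonneg _) hy0))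
      have h3 : y * (K * y) = K * (μ * exp (L * x)) := by rw [← hsq]; ring
      simp only [Pi.sub_apply]
      generalize (H c x + π / 2) / x = s at *
      generalize (H c₀ x + π / 2) / x = s₀ at *
      generalize Z c x / x = ζ at *
      generalize Z c₀ x / x = ζ₀ at *
      have h4 : 0 ≤ 4 * ((s - s₀) - (H' c x - H' c₀ x)) ^ 2 / x := by positivity
      have h5 : μ * (exp (L * x) * L) = 4 * (K * (μ * exp (L * x))) + μ * exp (L * x) := by
        rw [hL]; ring
      rw [h5]
      refine lt_of_eq_of_lt (b := -(4 * ((s - s₀) - (H' c x - H' c₀ x)) ^ 2 / x)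
        + 2 * ((H' c x - H' c₀ x) * (G - G₀)) + 2 * ((ζ - ζ₀) * (J - J₀))) ?_ (by linarith)
      field_simp
      ring
  have hlt : r < ρ₁ c := by
    by_contra! hle
    refine hq.not_ge (le_of_tendsto (hend c hc) ?_)
    filter_upwards [Ioo_mem_nhdsLT h.rho1_pos] with x hx
    exact (htube c hc x hx (hx.2.le.trans hle) ((hbound x hx (hx.2.le.trans hle)).trans
      (by linarith [min_le_left η ε]))).1
  refine ⟨hlt, fun ρ hρ => (hbound ρ ⟨hρ.1, hρ.2.trans_lt hlt⟩ hρ.2).trans_lt ?_⟩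
  linarith [min_le_right η ε]

end Family

/-- Lemma 9: if `H̄(c̃) ≠ 0` then the nodal number `N(c)` (the number of zeros
of `H(·,c)` on `[0, ρ₁(c))`) equals `N(c̃)` for all `c` close to `c̃`. -/
theorem lemma9 (α : ℝ) (hα0 : 0 < α) (hα : α < 1 / 2)
    (H H' A Z : ℝ → ℝ → ℝ) (ρ₁ : ℝ → ℝ)
    (horb : ∀ c, 0 < c → IsCOrbit α c (H c) (H' c) (A c) (Z c) (ρ₁ c))
    (hend : ∀ c, 0 < c → Tendsto (Z c) (𝓝[<] ρ₁ c) (𝓝 1))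
    (ct : ℝ) (hct : 0 < ct) (Hbar : ℝ)
    (hHbar : Tendsto (H ct) (𝓝[<] ρ₁ ct) (𝓝 Hbar)) (hne : Hbar ≠ 0) :
    ∃ δ > 0, ∀ c, 0 < c → |c - ct| < δ →
      {ρ ∈ Set.Ioo 0 (ρ₁ c) | H c ρ = 0}.ncard
        = {ρ ∈ Set.Ioo 0 (ρ₁ ct) | H ct ρ = 0}.ncard := by
  have h₀ := horb ct hct
  have hα1 : 0 < 1 - 2 * α := by linarith
  set e := |Hbar| with he
  have he0 : 0 < e := abs_pos.2 hne
  set k := (1 - 2 * α) * e / 4 with hk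
  have hk0 : 0 < k := by positivity
  have hk' : k / (2 * (1 - 2 * α)) = e / 8 := by
    rw [hk]
    field_simp
    ring
  have hcont : Tendsto (fun z : ℝ => (1 / z - 1) / (2 * k)) (𝓝 1) (𝓝 0) := by
    have : ContinuousAt (fun z : ℝ => (1 / z - 1) / (2 * k)) 1 := by
      fun_prop (disch := norm_num)
    simpa [ContinuousAt] using this
  obtain ⟨r, ⟨hrH, hrZ⟩, hr⟩ := (((hHbar.eventually (Metric.ball_mem_nhds Hbar
    (by positivity : 0 < e / 4))).and ((hcont.comp (hend ct hct)).eventually_lt_const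
    (by positivity : (0 : ℝ) < e / 8))).and (Ioo_mem_nhdsLT h₀.rho1_pos)).exists
  have hr0 : 0 < r := hr.1
  rw [Real.dist_eq] at hrH
  have hHr : 3 * e / 4 < |H ct r| := by
    have := abs_sub_abs_le_abs_sub Hbar (H ct r)
    rw [abs_sub_comm] at this
    linarith
  have hZr := h₀.Z_pos hα0 hr
  obtain ⟨κ, hκ, hκZ⟩ : ∃ κ > 0, ∀ z, |z - Z ct r| < κ → (1 / z - 1) / (2 * k) < e / 8 := by
    have hc : ContinuousAt (fun z : ℝ => (1 / z - 1) / (2 * k)) (Z ct r) := by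
      fun_prop (disch := exact hZr.ne')
    obtain ⟨κ, hκ, h⟩ := Metric.eventually_nhds_iff.1 (Tendsto.eventually_lt_const hrZ hc)
    exact ⟨κ, hκ, fun z hz => h hz⟩
  obtain ⟨a, ha0, har, ha⟩ : ∃ a > 0, a < r ∧ ∀ x ∈ Ioc 0 a, H ct x < -1 := by
    have h1 := h₀.Hcont.eventually_lt_const (u := -1) (by linarith [pi_gt_three])
    obtain ⟨b, hb, hb'⟩ := (mem_nhdsGT_iff_exists_Ioo_subset).1 h1
    have hb : 0 < b := hb
    refine ⟨min b r / 2, by positivity, by linarith [min_le_right b r], fun x hx => hb' ⟨hx.1, ?_⟩⟩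
    have := lt_min hb hr0
    linarith [hx.2, min_le_left b r]
  have hsub : ∀ x ∈ Icc a r, x ∈ Ioc 0 r := fun x hx => ⟨ha0.trans_le hx.1, hx.2⟩
  have hsub₀ : ∀ x ∈ Icc a r, x ∈ Ioo 0 (ρ₁ ct) := fun x hx =>
    ⟨ha0.trans_le hx.1, hx.2.trans_lt hr.2⟩
  obtain ⟨ε, hε, hzeros⟩ := exists_encard_zeros_eq_of_close har.le
    (fun x hx => h₀.hH x (hsub₀ x hx))
    (fun x hx => (h₀.hH' x (hsub₀ x hx)).continuousAt.continuousWithinAt)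
    (by linarith [ha a ⟨ha0, le_rfl⟩] : H ct a < 0).ne (abs_pos.1 (by linarith))
    (fun x hx => h₀.H'_ne_zero hα0 hHbar hne (hsub₀ x hx))
  set θ := min (min ε κ) (min (e / 8) (1 / 2)) with hθ
  have hθ0 : 0 < θ := by positivity
  obtain ⟨δ, hδ, hclose⟩ := exists_forall_sqGap_lt hα0 hα horb hend hct hr
    (by positivity : 0 < (θ / (1 + r)) ^ 2)
  have hHZ : ∀ c, 0 < c → |c - ct| < δ → ∀ x ∈ Ioc 0 r,
      |H c x - H ct x| < θ ∧ |H' c x - H' ct x| < θ ∧ |Z c x - Z ct x| < θ := by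
    intro c hc hcδ x hx
    have hx0 : 0 < x := hx.1
    have h1 : √(sqGap H H' Z ct c x) < θ / (1 + r) :=
      (sqrt_lt' (by positivity)).2 ((hclose c hc hcδ).2 x hx)
    have hmul : ∀ u v : ℝ, |u / x - v / x| ≤ √(sqGap H H' Z ct c x) → |u - v| < θ := by
      intro u v huv
      rw [← sub_div, abs_div, abs_of_pos hx0, div_le_iff₀ hx0] at huv
      rw [lt_div_iff₀ (by positivity)] at h1
      have := mul_le_mul_of_nonneg_left hx.2 (sqrt_nonneg (sqGap H H' Z ct c x))
      linarith [sqrt_nonneg (sqGap H H' Z ct c x)]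
    refine ⟨?_, ?_, hmul _ _ (abs_Z_sub_le_sqrt_sqGap H H' Z ct c x)⟩
    · simpa using hmul _ _ (abs_H_sub_le_sqrt_sqGap H H' Z ct c x)
    · exact (abs_H'_sub_le_sqrt_sqGap H H' Z ct c x).trans_lt
        (h1.trans_le (div_le_self hθ0.le (by linarith)))
  have hθ1 : θ ≤ ε := (min_le_left _ _).trans (min_le_left _ _)
  have hθ2 : θ ≤ κ := (min_le_left _ _).trans (min_le_right _ _)
  have hθ3 : θ ≤ e / 8 := (min_le_right _ _).trans (min_le_left _ _)
  have hθ4 : θ ≤ 1 / 2 := (min_le_right _ _).trans (min_le_right _ _)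
  have hset : ∀ c, 0 < c → |c - ct| < δ →
      {ρ ∈ Ioo 0 (ρ₁ c) | H c ρ = 0} = {ρ ∈ Icc a r | H c ρ = 0} := by
    intro c hc hcδ
    have hr' : r ∈ Ioo 0 (ρ₁ c) := ⟨hr0, (hclose c hc hcδ).1⟩
    ext x
    refine ⟨fun ⟨hx, hx0⟩ => ⟨⟨?_, ?_⟩, hx0⟩, fun ⟨hx, hx0⟩ =>
      ⟨⟨ha0.trans_le hx.1, hx.2.trans_lt hr'.2⟩, hx0⟩⟩
    · by_contra! hxa
      have h1 := (abs_lt.1 (hHZ c hc hcδ x ⟨hx.1, by linarith⟩).1).2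
      linarith [ha x ⟨hx.1, hxa.le⟩]
    · by_contra! hxr
      obtain ⟨h1, -, h2⟩ := hHZ c hc hcδ r ⟨hr0, le_rfl⟩
      have h3 := (horb c hc).abs_H_sub_le hα0 hα hk0 hr' ⟨hxr.le, hx.2⟩
      rw [hx0, zero_sub, abs_neg, hk'] at h3
      have h4 := hκZ _ (h2.trans_le hθ2)
      have h5 := abs_sub_abs_le_abs_sub (H ct r) (H c r)
      rw [abs_sub_comm] at h5
      linarith
  refine ⟨δ, hδ, fun c hc hcδ => ?_⟩
  rw [hset c hc hcδ, hset ct hct (by simpa), ncard_def, ncard_def]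
  congr 1
  refine hzeros (H c) (H' c) (fun x hx => (horb c hc).hH x ?_) (fun x hx => ?_) (fun x hx => ?_)
  · exact ⟨ha0.trans_le hx.1, hx.2.trans_lt (hclose c hc hcδ).1⟩
  · rw [abs_sub_comm]
    exact (hHZ c hc hcδ x (hsub x hx)).1.trans_le hθ1
  · rw [abs_sub_comm]
    exact (hHZ c hc hcδ x (hsub x hx)).2.1.trans_le hθ1
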